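/- For every integer a ≥ 3, every type-1 configuration of [a,2,1] admits a proper 6-coloring. -/

import Mathlib

/-- A cuboid with integer root and integer dimensions. -/
structure Cuboid where
  root : ℤ × ℤ × ℤ
  dims : ℤ × ℤ × ℤ
deriving DecidableEq

namespace Cuboid

/-- The dimensions are positive. -/
def valid (C : Cuboid) : Prop :=
  0 < C.dims.1 ∧ 0 < C.dims.2.1 ∧ 0 < C.dims.2.2

/-- The closed cuboid `[x,x+a] × [y,y+b] × [z,z+c] ⊆ ℝ³`. -/
def toSet (C : Cuboid) : Set (ℝ × ℝ × ℝ) :=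
  {p | (C.root.1 : ℝ) ≤ p.1 ∧ p.1 ≤ C.root.1 + C.dims.1 ∧
       (C.root.2.1 : ℝ) ≤ p.2.1 ∧ p.2.1 ≤ C.root.2.1 + C.dims.2.1 ∧
       (C.root.2.2 : ℝ) ≤ p.2.2 ∧ p.2.2 ≤ C.root.2.2 + C.dims.2.2}

/-- The open cuboid `(x,x+a) × (y,y+b) × (z,z+c) ⊆ ℝ³` (the interior). -/
def inte (C : Cuboid) : Set (ℝ × ℝ × ℝ) :=
  {p | (C.root.1 : ℝ) < p.1 ∧ p.1 < C.root.1 + C.dims.1 ∧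
       (C.root.2.1 : ℝ) < p.2.1 ∧ p.2.1 < C.root.2.1 + C.dims.2.1 ∧
       (C.root.2.2 : ℝ) < p.2.2 ∧ p.2.2 < C.root.2.2 + C.dims.2.2}

/-- The set `(ℤ×ℤ×ℝ) ∪ (ℤ×ℝ×ℤ) ∪ (ℝ×ℤ×ℤ)` of grid lines. -/
def grid : Set (ℝ × ℝ × ℝ) :=
  {p | ((∃ m : ℤ, p.1 = m) ∧ (∃ n : ℤ, p.2.1 = n)) ∨
       ((∃ m : ℤ, p.1 = m) ∧ (∃ n : ℤ, p.2.2 = n)) ∨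
       ((∃ m : ℤ, p.2.1 = m) ∧ (∃ n : ℤ, p.2.2 = n))}

/-- Two cuboids collide when their interiors intersect. -/
def Collide (C D : Cuboid) : Prop := (C.inte ∩ D.inte).Nonempty

/-- Two cuboids touch when their interiors are disjoint but their intersection
contains a point outside the grid lines (i.e. it is a non-degenerate rectangle). -/
def Touch (C D : Cuboid) : Prop :=
  ¬ Collide C D ∧ ∃ p ∈ C.toSet ∩ D.toSet, p ∉ grid

end Cuboid

/-- A configuration: a finite family of valid pairwise non-colliding cuboids. -/
def IsConfig (F : Finset Cuboid) : Prop :=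
  (∀ C ∈ F, C.valid) ∧ ∀ C ∈ F, ∀ D ∈ F, C ≠ D → ¬ Cuboid.Collide C D

/-- A type-1 configuration of `[a,b,c]`: every cuboid has dimensions exactly `(a,b,c)`. -/
def Type1 (a b c : ℕ) (F : Finset Cuboid) : Prop :=
  ∀ C ∈ F, C.dims = ((a : ℤ), (b : ℤ), (c : ℤ))

/-- A type-2 configuration of `[a,b,c]`: every cuboid has dimensions `(a,b,c)` or `(b,a,c)`. -/
def Type2 (a b c : ℕ) (F : Finset Cuboid) : Prop :=
  ∀ C ∈ F, C.dims = ((a : ℤ), (b : ℤ), (c : ℤ)) ∨ C.dims = ((b : ℤ), (a : ℤ), (c : ℤ))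

/-- A type-3 configuration of `[a,b,c]`: every cuboid's dimensions are a permutation of `(a,b,c)`. -/
def Type3 (a b c : ℕ) (F : Finset Cuboid) : Prop :=
  ∀ C ∈ F, C.dims = ((a : ℤ), (b : ℤ), (c : ℤ)) ∨ C.dims = ((a : ℤ), (c : ℤ), (b : ℤ)) ∨
    C.dims = ((b : ℤ), (a : ℤ), (c : ℤ)) ∨ C.dims = ((b : ℤ), (c : ℤ), (a : ℤ)) ∨
    C.dims = ((c : ℤ), (a : ℤ), (b : ℤ)) ∨ C.dims = ((c : ℤ), (b : ℤ), (a : ℤ))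

/-- A proper `k`-coloring of a configuration: touching cuboids get distinct colors. -/
def ProperColoring (k : ℕ) (F : Finset Cuboid) : Prop :=
  ∃ κ : Cuboid → Fin k, ∀ C ∈ F, ∀ D ∈ F, Cuboid.Touch C D → κ C ≠ κ D

namespace Cuboid

/-- The midpoint of the hull of two overlapping intervals of length `l` is interior to both. -/
theorem midpoint_mem_Ioo {s t l : ℤ} (h₁ : t - s < l) (h₂ : s - t < l) :
    ((s : ℝ) < (s + t + l) / 2 ∧ ((s : ℝ) + t + l) / 2 < s + l) ∧
      ((t : ℝ) < (s + t + l) / 2 ∧ ((s : ℝ) + t + l) / 2 < t + l) := by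
  have h₁' : (t : ℝ) - s < l := by exact_mod_cast h₁
  have h₂' : (s : ℝ) - t < l := by exact_mod_cast h₂
  refine ⟨⟨?_, ?_⟩, ?_, ?_⟩ <;> linarith

/-- If two intervals of length `l` share the point `p`, their endpoints are at distance at most `l`,
and `p` is an integer when this distance is attained. -/
theorem dist_le_of_mem_Icc {s t l : ℤ} {p : ℝ} (hs : (s : ℝ) ≤ p) (hs' : p ≤ s + l)
    (ht : (t : ℝ) ≤ p) (ht' : p ≤ t + l) :
    t - s ≤ l ∧ s - t ≤ l ∧ ((∃ m : ℤ, p = m) ∨ (t - s < l ∧ s - t < l)) := by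
  have h₁ : t - s ≤ l := by
    have : (t : ℝ) ≤ s + l := ht.trans hs'
    have : t ≤ s + l := by exact_mod_cast this
    omega
  have h₂ : s - t ≤ l := by
    have : (s : ℝ) ≤ t + l := hs.trans ht'
    have : s ≤ t + l := by exact_mod_cast this
    omega
  refine ⟨h₁, h₂, ?_⟩
  rcases h₁.eq_or_lt with h | h₁
  · left
    refine ⟨t, le_antisymm ?_ ht⟩
    have : (t : ℝ) - s = l := by exact_mod_cast h
    linarith
  rcases h₂.eq_or_lt with h | h₂
  · left
    refine ⟨s, le_antisymm ?_ hs⟩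
    have : (s : ℝ) - t = l := by exact_mod_cast h
    linarith
  exact Or.inr ⟨h₁, h₂⟩

/-- Touching translates of a cuboid overlap strictly in two directions and abut in the third. -/
theorem Touch.root_sub {C D : Cuboid} {a b c : ℤ} (hC : C.dims = (a, b, c))
    (hD : D.dims = (a, b, c)) (h : Touch C D) :
    (|D.root.1 - C.root.1| = a ∧ |D.root.2.1 - C.root.2.1| < b ∧ |D.root.2.2 - C.root.2.2| < c) ∨
    (|D.root.1 - C.root.1| < a ∧ |D.root.2.1 - C.root.2.1| = b ∧ |D.root.2.2 - C.root.2.2| < c) ∨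
    (|D.root.1 - C.root.1| < a ∧ |D.root.2.1 - C.root.2.1| < b ∧ |D.root.2.2 - C.root.2.2| = c) := by
  obtain ⟨⟨x, y, z⟩, dC⟩ := C
  obtain ⟨⟨x', y', z'⟩, dD⟩ := D
  obtain rfl : dC = (a, b, c) := hC
  obtain rfl : dD = (a, b, c) := hD
  obtain ⟨hcol, p, ⟨⟨c₁, c₂, c₃, c₄, c₅, c₆⟩, d₁, d₂, d₃, d₄, d₅, d₆⟩, hp⟩ := h
  obtain ⟨hx₁, hx₂, hx⟩ := dist_le_of_mem_Icc c₁ c₂ d₁ d₂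
  obtain ⟨hy₁, hy₂, hy⟩ := dist_le_of_mem_Icc c₃ c₄ d₃ d₄
  obtain ⟨hz₁, hz₂, hz⟩ := dist_le_of_mem_Icc c₅ c₆ d₅ d₆
  have hnot : ¬ ((x' - x < a ∧ x - x' < a) ∧ (y' - y < b ∧ y - y' < b) ∧
      (z' - z < c ∧ z - z' < c)) := by
    rintro ⟨⟨hx₁, hx₂⟩, ⟨hy₁, hy₂⟩, hz₁, hz₂⟩
    obtain ⟨⟨e₁, e₂⟩, e₃, e₄⟩ := midpoint_mem_Ioo hx₁ hx₂
    obtain ⟨⟨f₁, f₂⟩, f₃, f₄⟩ := midpoint_mem_Ioo hy₁ hy₂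
    obtain ⟨⟨g₁, g₂⟩, g₃, g₄⟩ := midpoint_mem_Ioo hz₁ hz₂
    exact hcol ⟨((x + x' + a) / 2, (y + y' + b) / 2, (z + z' + c) / 2),
      ⟨e₁, e₂, f₁, f₂, g₁, g₂⟩, e₃, e₄, f₃, f₄, g₃, g₄⟩
  have hxy : ¬ ((∃ m : ℤ, p.1 = m) ∧ ∃ n : ℤ, p.2.1 = n) := fun h => hp (Or.inl h)
  have hxz : ¬ ((∃ m : ℤ, p.1 = m) ∧ ∃ n : ℤ, p.2.2 = n) := fun h => hp (Or.inr (Or.inl h))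
  have hyz : ¬ ((∃ m : ℤ, p.2.1 = m) ∧ ∃ n : ℤ, p.2.2 = n) := fun h => hp (Or.inr (Or.inr h))
  dsimp only at *
  generalize (∃ m : ℤ, p.1 = m) = P at *
  generalize (∃ m : ℤ, p.2.1 = m) = Q at *
  generalize (∃ m : ℤ, p.2.2 = m) = R at *
  clear hcol hp c₁ c₂ c₃ c₄ c₅ c₆ d₁ d₂ d₃ d₄ d₅ d₆
  simp only [abs_eq_max_neg]
  by_cases hP : P <;> by_cases hQ : Q <;> by_cases hR : R <;>
    simp only [hP, hQ, hR, true_and, true_or, false_or, not_true_eq_false] at * <;> omega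

/-- The color, in `{0, …, 5}`, of an `[a, 2, 1]` cuboid: the class modulo `3` separates cuboids
meeting along a horizontal or a lateral face, the remaining bit those meeting end to end. -/
def colorIndex (a : ℤ) (C : Cuboid) : ℤ :=
  (C.root.2.1 + 3 * C.root.2.2) / 2 % 3 + 3 * (C.root.1 / a % 2)

theorem colorIndex_nonneg (a : ℤ) (C : Cuboid) : 0 ≤ colorIndex a C := by
  unfold colorIndex; omega

theorem colorIndex_lt (a : ℤ) (C : Cuboid) : colorIndex a C < 6 := by
  unfold colorIndex; omega

theorem colorIndex_ne_of_touch {a : ℤ} (ha : 0 < a) {C D : Cuboid} (hC : C.dims = (a, 2, 1))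
    (hD : D.dims = (a, 2, 1)) (h : Touch C D) : colorIndex a C ≠ colorIndex a D := by
  unfold colorIndex
  rcases h.root_sub hC hD with ⟨hx, -, -⟩ | ⟨-, hy, hz⟩ | ⟨-, hy, hz⟩
  · have key : D.root.1 / a = C.root.1 / a + 1 ∨ C.root.1 / a = D.root.1 / a + 1 := by
      rcases (abs_eq ha.le).1 hx with h | h
      · left
        rw [show D.root.1 = C.root.1 + a by omega, Int.add_ediv_of_dvd_right dvd_rfl,
          Int.ediv_self ha.ne']
      · right
        rw [show C.root.1 = D.root.1 + a by omega, Int.add_ediv_of_dvd_right dvd_rfl,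
          Int.ediv_self ha.ne']
    omega
  · rw [abs_eq (by norm_num)] at hy
    rw [abs_lt] at hz
    omega
  · rw [abs_lt] at hy
    rw [abs_eq (by norm_num)] at hz
    omega

end Cuboid

/-- For `a ≥ 3`, every type-1 configuration of `[a,2,1]` admits a proper 6-coloring. -/
theorem type1_a21_6colorable (a : ℕ) (ha : 3 ≤ a) :
    ∀ F : Finset Cuboid, IsConfig F → Type1 a 2 1 F → ProperColoring 6 F := by
  intro F _ hF
  have hlt (C : Cuboid) : (C.colorIndex a).toNat < 6 := by
    have := C.colorIndex_lt a
    omega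
  refine ⟨fun C => ⟨(C.colorIndex a).toNat, hlt C⟩, fun C hC D hD h heq => ?_⟩
  refine Cuboid.colorIndex_ne_of_touch (by omega) (hF C hC) (hF D hD) h ?_
  have := C.colorIndex_nonneg a
  have := D.colorIndex_nonneg a
  have := congrArg Fin.val heq
  dsimp only at this
  omega
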